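/- Let x be a feasible solution of the hypergraphic LP (S). For each terminal set K with x_K > 0, let F_K be the edge set of an arbitrary tree with vertex set exactly K (edges joining terminals of K), and let F be the disjoint (multiset) union of the F_K. Define z on F by z_e = x_K for every e coming from F_K. Then z lies in Edmonds' spanning tree polytope of the multigraph H = (R, F): z ≥ 0, for every nonempty S ⊆ R the total z-weight of edges of F with both endpoints in S is at most |S| − 1, and the total z-weight of all edges of F equals |R| − 1. -/

import Mathlib

open Finset

variable {V : Type} [Fintype V] [DecidableEq V]

/-- All pairs of vertices of `S`, as potential edges (the clique on `S`). -/
def cliqueEdges (S : Finset V) : Finset (Sym2 V) := (S ×ˢ S).image fun p => s(p.1, p.2)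

/-- Feasibility for the (purely combinatorial) hypergraphic LP (S) over the terminal set
`R`: `x` is nonnegative, supported on sets `K ⊆ R` with `|K| ≥ 2`, and satisfies
`∑_{K : K∩S ≠ ∅} x_K (|K∩S|-1) ≤ |S|-1` for every nonempty `S ⊆ R` as well as
`∑_K x_K (|K|-1) = |R|-1`. -/
def LPFeasiblePlain (R : Finset V) (x : Finset V → ℝ) : Prop :=
  (∀ K, 0 ≤ x K) ∧
  (∀ K : Finset V, x K ≠ 0 → K ⊆ R ∧ 2 ≤ K.card) ∧
  (∀ S ⊆ R, S.Nonempty →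
    ∑ K ∈ Finset.univ.filter (fun K : Finset V => (K ∩ S).Nonempty),
      x K * (((K ∩ S).card : ℝ) - 1) ≤ (S.card : ℝ) - 1) ∧
  (∑ K : Finset V, x K * ((K.card : ℝ) - 1) = (R.card : ℝ) - 1)

/-- `F` is (the edge set of) a tree with vertex set exactly `K`: its edges join vertices
of `K`, all vertices of `K` are mutually connected, and there are `|K| - 1` edges. -/
def IsTreeOn (K : Finset V) (F : Finset (Sym2 V)) : Prop :=
  (∀ e ∈ F, ∀ v ∈ e, v ∈ K) ∧
  (∀ u ∈ K, ∀ v ∈ K, (SimpleGraph.fromEdgeSet (↑F : Set (Sym2 V))).Reachable u v) ∧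
  F.card + 1 = K.card

/-!
STATEMENT 12: let `x` be feasible for the hypergraphic LP over `R`, and for each `K` with
`x K ≠ 0` let `FK K` be a tree with vertex set exactly `K`. Give each edge of the
multigraph `H = (R, ⨆_K FK K)` coming from `FK K` the weight `z_e = x K`. Then `z` lies
in Edmonds' spanning tree polytope of `H`: `z ≥ 0`, for every nonempty `S ⊆ R` the total
`z`-weight of edges with both endpoints in `S` is at most `|S| − 1`, and the total
`z`-weight of all edges is exactly `|R| − 1`. (Edges of `FK K` with both endpoints in `S`
are exactly those in `FK K ∩ cliqueEdges S`.)
-/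

theorem mem_of_mem_cliqueEdges {W : Type} [DecidableEq W] {S : Finset W} {e : Sym2 W}
    (he : e ∈ cliqueEdges S) {v : W} (hv : v ∈ e) : v ∈ S := by
  simp only [cliqueEdges, mem_image, mem_product] at he
  obtain ⟨p, ⟨h₁, h₂⟩, rfl⟩ := he
  rcases Sym2.mem_iff.1 hv with rfl | rfl <;> assumption

/-- In a connected graph, a vertex other than `r` has a neighbour strictly closer to `r`. -/
theorem SimpleGraph.Reachable.exists_adj_dist_lt {W : Type*} {G : SimpleGraph W} {v r : W}
    (h : G.Reachable v r) (hne : v ≠ r) : ∃ w, G.Adj v w ∧ G.dist w r < G.dist v r := by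
  obtain ⟨p, hp⟩ := h.exists_walk_length_eq_dist
  cases p with
  | nil => exact absurd rfl hne
  | cons hadj q =>
    refine ⟨_, hadj, ?_⟩
    have := SimpleGraph.dist_le q
    rw [SimpleGraph.Walk.length_cons] at hp
    omega

/-- Mapping each vertex outside `S` to the first edge of a shortest path to a root in `S`
is injective, so at least `|K \ S|` tree edges leave the clique on `S`. -/
theorem IsTreeOn.card_sdiff_le {W : Type} [DecidableEq W] {K S : Finset W}
    {F : Finset (Sym2 W)} (hF : IsTreeOn K F) (hKS : (K ∩ S).Nonempty) :
    (K \ S).card ≤ (F \ cliqueEdges S).card := by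
  obtain ⟨r, hr⟩ := hKS
  obtain ⟨hrK, hrS⟩ := mem_inter.1 hr
  set G := SimpleGraph.fromEdgeSet (↑F : Set (Sym2 W)) with hG
  have key : ∀ v ∈ K \ S, ∃ w, G.Adj v w ∧ G.dist w r < G.dist v r := by
    intro v hv
    obtain ⟨hvK, hvS⟩ := mem_sdiff.1 hv
    exact (hF.2.1 v hvK r hrK).exists_adj_dist_lt fun h => hvS (h ▸ hrS)
  choose! next hadj hlt using key
  refine card_le_card_of_injOn (fun v => s(v, next v)) ?_ ?_
  · intro v hv
    have hv' : v ∈ K \ S := hv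
    have h := hadj v hv'
    rw [hG, SimpleGraph.fromEdgeSet_adj] at h
    exact mem_sdiff.2 ⟨h.1, fun hc =>
      (mem_sdiff.1 hv').2 (mem_of_mem_cliqueEdges hc (Sym2.mem_mk_left _ _))⟩
  · intro v hv u hu huv
    rcases Sym2.eq_iff.1 huv with ⟨h, -⟩ | ⟨h₁, h₂⟩
    · exact h
    · have hv' := hlt v hv
      have hu' := hlt u hu
      rw [h₂] at hv'
      rw [← h₁] at hu'
      omega

theorem IsTreeOn.card_inter_cliqueEdges_add_one_le {W : Type} [DecidableEq W]
    {K S : Finset W} {F : Finset (Sym2 W)} (hF : IsTreeOn K F)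
    (hKS : (K ∩ S).Nonempty) :
    (F ∩ cliqueEdges S).card + 1 ≤ (K ∩ S).card := by
  have h := hF.card_sdiff_le hKS
  have hK := card_inter_add_card_sdiff K S
  have hE := card_inter_add_card_sdiff F (cliqueEdges S)
  have hc := hF.2.2
  omega

theorem IsTreeOn.inter_cliqueEdges_eq_empty {W : Type} [DecidableEq W]
    {K S : Finset W} {F : Finset (Sym2 W)} (hF : IsTreeOn K F)
    (hKS : ¬(K ∩ S).Nonempty) : F ∩ cliqueEdges S = ∅ := by
  refine eq_empty_of_forall_notMem fun e he => hKS ?_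
  obtain ⟨heF, heS⟩ := mem_inter.1 he
  have hv := e.out_fst_mem
  exact ⟨_, mem_inter.2 ⟨hF.1 e heF _ hv, mem_of_mem_cliqueEdges heS hv⟩⟩

theorem z_in_edmonds_spanning_tree_polytope
    (R : Finset V) (x : Finset V → ℝ) (hx : LPFeasiblePlain R x)
    (FK : Finset V → Finset (Sym2 V))
    (hFK : ∀ K : Finset V, x K ≠ 0 → IsTreeOn K (FK K)) :
    (∀ K : Finset V, 0 ≤ x K) ∧
    (∀ S ⊆ R, S.Nonempty →
      ∑ K : Finset V, x K * (((FK K ∩ cliqueEdges S).card : ℝ)) ≤ (S.card : ℝ) - 1) ∧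
    (∑ K : Finset V, x K * (((FK K).card : ℝ)) = (R.card : ℝ) - 1) := by
  obtain ⟨hx0, -, hS, hR⟩ := hx
  refine ⟨hx0, fun S hSR hSne => le_trans ?_ (hS S hSR hSne), ?_⟩
  · rw [sum_filter]
    refine sum_le_sum fun K _ => ?_
    by_cases hK : x K = 0
    · simp [hK]
    split_ifs with hKS
    · have h : ((FK K ∩ cliqueEdges S).card : ℝ) + 1 ≤ (K ∩ S).card :=
        mod_cast (hFK K hK).card_inter_cliqueEdges_add_one_le hKS
      exact mul_le_mul_of_nonneg_left (by linarith) (hx0 K)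
    · simp [(hFK K hK).inter_cliqueEdges_eq_empty hKS]
  · rw [← hR]
    refine sum_congr rfl fun K _ => ?_
    by_cases hK : x K = 0
    · simp [hK]
    · rw [← (hFK K hK).2.2]
      push_cast
      ring
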